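/- arXiv:1903.00222 — 2 statements merged into one kernel-verified Lean document; each statement's English description precedes it below -/
import Mathlib

section
/- Let T = (Q, Σ, δ) be an S-automaton and let L ⊆ Q* be a finitely suffix-closed language of state sequences. Then the set L∘ = {𝐪∘ ∣ 𝐪 ∈ L} of partial maps is finite if and only if there is a constant C ∈ ℕ such that |L∘u| ≤ C for every finite word u ∈ Σ*. -/
/- Common framework for automaton semigroups acting on finite and infinite words.

An S-automaton over states `Q` and alphabet `A` is given by a partial deterministic
transition function `δ : Q → A → Option (A × Q)` (with `δ q a = some (b, p)` encoding
the transition `q –a/b→ p`). -/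

namespace AutOrbit

variable {Q A : Type*}

/-- The partial action `q∘` of a single state on a finite word. -/
def stateAct (δ : Q → A → Option (A × Q)) : Q → List A → Option (List A)
  | _, [] => some []
  | q, a :: u => (δ q a).bind fun bp => (stateAct δ bp.2 u).map fun v => bp.1 :: v

/-- The partial action `𝐪∘` of a state sequence `𝐪 = q_n … q_1` (written left-to-right,
head of the list is `q_n`; the rightmost state `q_1` is applied first). -/
def seqAct (δ : Q → A → Option (A × Q)) (l : List Q) (u : List A) : Option (List A) :=
  l.foldr (fun q acc => acc.bind (stateAct δ q)) (some u)

/-- The length-`n` prefix of an ω-word. -/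
def pre (ξ : ℕ → A) (n : ℕ) : List A := List.ofFn fun i : Fin n => ξ i

/-- The `L`-orbit `L∘u` of a finite word `u`. -/
def orbit (δ : Q → A → Option (A × Q)) (L : Set (List Q)) (u : List A) : Set (List A) :=
  {v | ∃ l ∈ L, seqAct δ l u = some v}

/-- The `L`-orbit `L∘ξ` of an ω-word `ξ`: all ω-words `η` such that some `𝐪 ∈ L` is
defined on `ξ` with `𝐪∘ξ = η` (i.e. `𝐪∘` maps every prefix of `ξ` to the
corresponding prefix of `η`). -/
def omegaOrbit (δ : Q → A → Option (A × Q)) (L : Set (List Q)) (ξ : ℕ → A) :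
    Set (ℕ → A) :=
  {η | ∃ l ∈ L, ∀ n, seqAct δ l (pre ξ n) = some (pre η n)}

/-- The set of partial maps `L∘ = {𝐪∘ ∣ 𝐪 ∈ L}`. -/
def mapsOf (δ : Q → A → Option (A × Q)) (L : Set (List Q)) :
    Set (List A → Option (List A)) :=
  {f | ∃ l ∈ L, f = seqAct δ l}

/-- `L ⊆ F*` is suffix-closed over `F`: every `𝐪 ∈ L` factorizes into factors from `F`
such that every suffix (as a word over the alphabet `F`) of the factorization is
again in `L`. -/
def SuffixClosedOver (F L : Set (List Q)) : Prop :=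
  ∀ l ∈ L, ∃ fs : List (List Q),
    (∀ f ∈ fs, f ∈ F) ∧ fs.flatten = l ∧ ∀ i, (fs.drop i).flatten ∈ L

/-- `L` is finitely suffix-closed: suffix-closed over some finite nonempty `F ⊆ Q*`. -/
def FinitelySuffixClosed (L : Set (List Q)) : Prop :=
  ∃ F : Set (List Q), F.Finite ∧ F.Nonempty ∧ SuffixClosedOver F L

/-- `u` has infinite potential w.r.t. `δ` and `L`: the orbit sizes `|L∘ux|` are unbounded. -/
def InfinitePotential (δ : Q → A → Option (A × Q)) (L : Set (List Q)) (u : List A) : Prop :=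
  ∀ C : ℕ, ∃ x : List A, C < (orbit δ L (u ++ x)).ncard

/-- The `i`-th power `𝐪^i` of a state sequence. -/
def listPow (l : List Q) (i : ℕ) : List Q := (List.replicate i l).flatten

/-- `𝐪∘` has torsion: two distinct positive powers induce the same partial map. -/
def HasTorsion (δ : Q → A → Option (A × Q)) (l : List Q) : Prop :=
  ∃ i j : ℕ, 1 ≤ i ∧ 1 ≤ j ∧ i ≠ j ∧ seqAct δ (listPow l i) = seqAct δ (listPow l j)

/-- The automaton is complete: `δ` is total. -/
def Complete (δ : Q → A → Option (A × Q)) : Prop := ∀ q a, (δ q a).isSome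

/-- The automaton is invertible: for every state, the letter-to-output-letter map is a
bijection of the alphabet (each output letter is produced by exactly one input letter). -/
def Invertible (δ : Q → A → Option (A × Q)) : Prop :=
  ∀ q b, ∃! a, ∃ p, δ q a = some (b, p)

/-- A G-automaton: a complete invertible S-automaton. -/
def GAutomaton (δ : Q → A → Option (A × Q)) : Prop := Complete δ ∧ Invertible δ

/-- Reversibility: for every input letter `a` and target state `p` there is at most one
transition `q –a/b→ p`. -/
def Reversible (δ : Q → A → Option (A × Q)) : Prop :=
  ∀ a p q₁ b₁ q₂ b₂, δ q₁ a = some (b₁, p) → δ q₂ a = some (b₂, p) → q₁ = q₂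

/-- Reversibility of the inverse automaton: for every output letter `b` and target
state `p` there is at most one transition `q –a/b→ p`. -/
def InvReversible (δ : Q → A → Option (A × Q)) : Prop :=
  ∀ b p q₁ a₁ q₂ a₂, δ q₁ a₁ = some (b, p) → δ q₂ a₂ = some (b, p) → q₁ = q₂ ∧ a₁ = a₂

/-- Bi-reversibility: the automaton and its inverse automaton are both reversible. -/
def BiReversible (δ : Q → A → Option (A × Q)) : Prop := Reversible δ ∧ InvReversible δ

/-- The dual automaton `∂T`: states are letters, letters are states; it has a transition
`a –q/p→ b` for every transition `q –a/b→ p` of `T`. -/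
def dual (δ : Q → A → Option (A × Q)) : A → Q → Option (Q × A) :=
  fun a q => (δ q a).map fun bp => (bp.2, bp.1)

/-- Adjacency of states in the underlying undirected graph of the automaton. -/
def Adj (δ : Q → A → Option (A × Q)) (q p : Q) : Prop :=
  (∃ a b, δ q a = some (b, p)) ∨ (∃ a b, δ p a = some (b, q))

/-- `P` is (the state set of) a connected component of the automaton. -/
def IsComponent (δ : Q → A → Option (A × Q)) (P : Set Q) : Prop :=
  ∃ q, P = {p | Relation.ReflTransGen (Adj δ) q p}

/-- The sub-automaton induced on `P` (with all transitions among states of `P`)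
is reversible. -/
def SubReversible (δ : Q → A → Option (A × Q)) (P : Set Q) : Prop :=
  ∀ a : A, ∀ p ∈ P, ∀ q₁ b₁ q₂ b₂, q₁ ∈ P → q₂ ∈ P →
    δ q₁ a = some (b₁, p) → δ q₂ a = some (b₂, p) → q₁ = q₂

/-- The inverse of the sub-automaton induced on `P` is reversible. -/
def SubInvReversible (δ : Q → A → Option (A × Q)) (P : Set Q) : Prop :=
  ∀ b : A, ∀ p ∈ P, ∀ q₁ a₁ q₂ a₂, q₁ ∈ P → q₂ ∈ P →
    δ q₁ a₁ = some (b, p) → δ q₂ a₂ = some (b, p) → q₁ = q₂ ∧ a₁ = a₂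

/-- The sub-automaton induced on `P` is bi-reversible. -/
def SubBiReversible (δ : Q → A → Option (A × Q)) (P : Set Q) : Prop :=
  SubReversible δ P ∧ SubInvReversible δ P

/-- For a complete automaton, the (total) action of a state on a finite word. -/
noncomputable def totAct (δ : Q → A → Option (A × Q)) (q : Q) (u : List A) : List A :=
  (stateAct δ q u).getD u

/-- The action of a state of the automaton (`Sum.inl`) or of its inverse automaton
(`Sum.inr`): for a G-automaton, `totAct δ q` is a bijection of `Σ*` and the inverse
state `q̄` acts as its inverse bijection. -/
noncomputable def gAct (δ : Q → A → Option (A × Q)) : Q ⊕ Q → List A → List A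
  | Sum.inl q => totAct δ q
  | Sum.inr q => Function.invFun (totAct δ q)

/-- Action of a sequence over `Q ⊔ Q̄` (rightmost entry applied first). -/
noncomputable def gSeqAct (δ : Q → A → Option (A × Q)) (l : List (Q ⊕ Q)) (u : List A) :
    List A :=
  l.foldr (fun s v => gAct δ s v) u

/-- The automaton group `G(T) = {𝐪∘ ∣ 𝐪 ∈ (Q ⊔ Q̄)⁺}` as a set of maps on `Σ*`. -/
def autGroup (δ : Q → A → Option (A × Q)) : Set (List A → List A) :=
  {f | ∃ l : List (Q ⊕ Q), l ≠ [] ∧ f = gSeqAct δ l}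

/-- The ultimately periodic ω-word `u (a v)^ω`. -/
def ultPer (u : List A) (a : A) (v : List A) (n : ℕ) : A :=
  if h : n < u.length then u.get ⟨n, h⟩
  else (a :: v).get ⟨(n - u.length) % (a :: v).length, Nat.mod_lt _ (by simp)⟩

/-- Run of a single state on a word, returning the output word and the final state. -/
def runState (δ : Q → A → Option (A × Q)) : Q → List A → Option (List A × Q)
  | q, [] => some ([], q)
  | q, a :: u => (δ q a).bind fun bp =>
      (runState δ bp.2 u).map fun vr => (bp.1 :: vr.1, vr.2)

/-- Run of a state sequence `𝐪` on a word `u`, returning the output word `𝐪∘u` and the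
residual state sequence `𝐪·u` (the dual action). -/
def runSeq (δ : Q → A → Option (A × Q)) : List Q → List A → Option (List A × List Q)
  | [], u => some (u, [])
  | q :: l, u => (runSeq δ l u).bind fun vr =>
      (runState δ q vr.1).map fun wp => (wp.1, wp.2 :: vr.2)

/-- Nodes of the `L`-orbital transducer over `F` of `u`: words reached from `u` along a
path of `F`-labeled edges whose reverse label (a word over `F`) lies in `L`. -/
def transNodes (δ : Q → A → Option (A × Q)) (F L : Set (List Q)) (u : List A) :
    Set (List A) :=
  {v | ∃ fs : List (List Q), (∀ f ∈ fs, f ∈ F) ∧ fs.flatten ∈ L ∧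
        ∃ r, runSeq δ fs.flatten u = some (v, r)}

/-- Edges of the `L`-orbital transducer over `F` of `u`: an edge `v –𝐩/𝐨→ w` with
`𝐩 ∈ F`, input label `𝐩`, output label `𝐨 = 𝐩·v`, lying on a path from `u` whose
reverse label is in `L`. -/
def transEdge (δ : Q → A → Option (A × Q)) (F L : Set (List Q)) (u : List A)
    (v : List A) (p o : List Q) (w : List A) : Prop :=
  p ∈ F ∧ ∃ fs : List (List Q), (∀ f ∈ fs, f ∈ F) ∧ (p :: fs).flatten ∈ L ∧
    (∃ r, runSeq δ fs.flatten u = some (v, r)) ∧ runSeq δ p v = some (w, o)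

/-- Isomorphism of the `L`-orbital transducers over `F` of `u₁` and `u₂`: a bijection of
the node sets mapping `u₁` to `u₂` and preserving labeled edges in both directions. -/
def TransducerIso (δ : Q → A → Option (A × Q)) (F L : Set (List Q)) (u₁ u₂ : List A) :
    Prop :=
  ∃ φ : List A → List A,
    Set.BijOn φ (transNodes δ F L u₁) (transNodes δ F L u₂) ∧ φ u₁ = u₂ ∧
    ∀ v ∈ transNodes δ F L u₁, ∀ w ∈ transNodes δ F L u₁, ∀ p o : List Q,
      (transEdge δ F L u₁ v p o w ↔ transEdge δ F L u₂ (φ v) p o (φ w))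


theorem length_of_stateAct_eq_some {δ : Q → A → Option (A × Q)} {q : Q} {u v : List A}
    (h : stateAct δ q u = some v) : v.length = u.length := by
  induction u generalizing q v with
  | nil => simp_all [stateAct]
  | cons a u ih =>
    simp only [stateAct, Option.bind_eq_some_iff, Option.map_eq_some_iff] at h
    obtain ⟨bp, -, w, hw, rfl⟩ := h
    simp [ih hw]

theorem length_of_seqAct_eq_some {δ : Q → A → Option (A × Q)} {l : List Q} {u v : List A}
    (h : seqAct δ l u = some v) : v.length = u.length := by
  induction l generalizing v with
  | nil => simp_all [seqAct]
  | cons q l ih =>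
    simp only [seqAct, List.foldr_cons, Option.bind_eq_some_iff] at h
    obtain ⟨w, hw, hv⟩ := h
    rw [length_of_stateAct_eq_some hv, ih hw]

theorem seqAct_append (δ : Q → A → Option (A × Q)) (l l' : List Q) (u : List A) :
    seqAct δ (l ++ l') u = (seqAct δ l' u).bind (seqAct δ l) := by
  induction l with
  | nil => exact (Option.bind_fun_some _).symm
  | cons q l ih =>
    exact (congrArg (fun x => x.bind (stateAct δ q)) ih).trans (Option.bind_assoc _ _ _)

theorem orbit_finite [Finite A] (δ : Q → A → Option (A × Q)) (L : Set (List Q)) (u : List A) :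
    (orbit δ L u).Finite :=
  (List.finite_length_eq A u.length).subset fun _ ⟨_, _, h⟩ => length_of_seqAct_eq_some h

theorem orbit_eq_preimage_image (δ : Q → A → Option (A × Q)) (L : Set (List Q)) (u : List A) :
    orbit δ L u = some ⁻¹' ((fun f => f u) '' mapsOf δ L) := by
  ext v
  simp [orbit, mapsOf]

/-- The path labeled `fs`, read from right to left, starting at `x` in the deterministic partial
graph on `X` with edge labels in `B`. -/
def graphPath {B X : Type*} (g : B → X → Option X) (fs : List B) (x : X) : Option X :=
  fs.foldr (fun f acc => acc.bind (g f)) (some x)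

/-- If all suffixes of `fs` lie in `L`, then the action of `fs` on `u` can be read off from any
graph that represents the action of the factors on `L∘u`. -/
theorem graphPath_eq_map_seqAct {X : Type*} {δ : Q → A → Option (A × Q)} {F L : Set (List Q)}
    {u : List A} {e : List A → X} {g : F → X → Option X}
    (hg : ∀ f, ∀ v ∈ orbit δ L u, g f (e v) = (seqAct δ f v).map e)
    (fs : List F) (hfs : ∀ i, ((fs.map Subtype.val).drop i).flatten ∈ L) :
    graphPath g fs (e u) = (seqAct δ (fs.map Subtype.val).flatten u).map e := by
  induction fs with
  | nil => simp [graphPath, seqAct]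
  | cons f fs ih =>
    have ih := ih fun i => by simpa using hfs (i + 1)
    have hmem : (fs.map Subtype.val).flatten ∈ L := by simpa using hfs 1
    simp only [graphPath, List.foldr_cons, List.map_cons, List.flatten_cons] at ih ⊢
    rw [ih, seqAct_append]
    cases h : seqAct δ (fs.map Subtype.val).flatten u with
    | none => simp
    | some v => simpa using hg f v ⟨_, hmem, h⟩

/-- Two factorizations tracing equal paths in every partial graph with `C + 1` nodes induce the
same partial map, provided all `L`-orbits have size at most `C`. -/
theorem seqAct_eq_of_graphPath_eq [Finite A] {δ : Q → A → Option (A × Q)}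
    {F L : Set (List Q)} {C : ℕ} (hC : ∀ u, (orbit δ L u).ncard ≤ C) {fs fs' : List F}
    (hfs : ∀ i, ((fs.map Subtype.val).drop i).flatten ∈ L)
    (hfs' : ∀ i, ((fs'.map Subtype.val).drop i).flatten ∈ L)
    (h : ∀ g : F → Fin (C + 1) → Option (Fin (C + 1)), graphPath g fs = graphPath g fs') :
    seqAct δ (fs.map Subtype.val).flatten = seqAct δ (fs'.map Subtype.val).flatten := by
  funext u
  have hfin := orbit_finite δ L u
  obtain ⟨e, -, he⟩ : ∃ e : List A → Fin (C + 1),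
      orbit δ L u ⊆ e ⁻¹' Set.univ ∧ Set.InjOn e (orbit δ L u) := by
    refine hfin.exists_injOn_of_encard_le ?_
    rw [← hfin.cast_ncard_eq, Set.encard_univ, ENat.card_eq_coe_fintype_card, Fintype.card_fin]
    exact_mod_cast (hC u).trans C.le_succ
  let g : F → Fin (C + 1) → Option (Fin (C + 1)) :=
    fun f x => (seqAct δ f (Function.invFunOn e (orbit δ L u) x)).map e
  have hg : ∀ f, ∀ v ∈ orbit δ L u, g f (e v) = (seqAct δ f v).map e := fun f v hv => by
    simp only [g, he.leftInvOn_invFunOn hv]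
  have key := congrFun (h g) (e u)
  rw [graphPath_eq_map_seqAct hg fs hfs, graphPath_eq_map_seqAct hg fs' hfs'] at key
  have hmem : (fs.map Subtype.val).flatten ∈ L := by simpa using hfs 0
  have hmem' : (fs'.map Subtype.val).flatten ∈ L := by simpa using hfs' 0
  cases hv : seqAct δ (fs.map Subtype.val).flatten u <;>
    cases hw : seqAct δ (fs'.map Subtype.val).flatten u <;> simp only [hv, hw] at key
  · rfl
  · simp at key
  · simp at key
  · exact congrArg some (he ⟨_, hmem, hv⟩ ⟨_, hmem', hw⟩ (by simpa using key))

theorem SuffixClosedOver.mapsOf_finite [Finite A] {δ : Q → A → Option (A × Q)}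
    {F L : Set (List Q)} (hF : F.Finite) (hL : SuffixClosedOver F L) {C : ℕ}
    (hC : ∀ u, (orbit δ L u).ncard ≤ C) : (mapsOf δ L).Finite := by
  have : Finite F := hF
  have hex : ∀ l : L, ∃ fs : List F, (fs.map Subtype.val).flatten = l ∧
      ∀ i, ((fs.map Subtype.val).drop i).flatten ∈ L := fun l => by
    obtain ⟨fs, hmem, hl, hsuf⟩ := hL l l.2
    lift fs to List F using hmem
    exact ⟨fs, hl, hsuf⟩
  choose fs hl hsuf using hex
  let Φ : L → (F → Fin (C + 1) → Option (Fin (C + 1))) → Fin (C + 1) → Option (Fin (C + 1)) :=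
    fun l g => graphPath g (fs l)
  have hΦ : (fun l : L => seqAct δ l).FactorsThrough Φ := fun l l' h => by
    simpa only [hl] using seqAct_eq_of_graphPath_eq hC (hsuf l) (hsuf l') (congrFun h)
  refine (Set.finite_range (Function.extend Φ (fun l : L => seqAct δ l) fun _ _ => none)).subset ?_
  rintro _ ⟨l, hmem, rfl⟩
  exact ⟨Φ ⟨l, hmem⟩, hΦ.extend_apply _ _⟩

/-- For an S-automaton `T = (Q, Σ, δ)` and a finitely suffix-closed
language `L ⊆ Q*`, the set `L∘ = {𝐪∘ ∣ 𝐪 ∈ L}` of partial maps is finite iff there is a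
constant `C` bounding the size of every orbit `L∘u`, `u ∈ Σ*`. -/
theorem mapsOf_finite_iff_orbits_bounded {Q A : Type*} [Fintype Q] [Fintype A] [Nonempty A]
    (δ : Q → A → Option (A × Q)) (L : Set (List Q)) (hL : FinitelySuffixClosed L) :
    (mapsOf δ L).Finite ↔ ∃ C : ℕ, ∀ u : List A, (orbit δ L u).ncard ≤ C := by
  constructor
  · refine fun h => ⟨(mapsOf δ L).ncard, fun u => ?_⟩
    have hfin := h.image fun f => f u
    rw [orbit_eq_preimage_image, ← Set.ncard_image_of_injective _ (Option.some_injective _)]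
    exact (Set.ncard_le_ncard (Set.image_preimage_subset _ _) hfin).trans (Set.ncard_image_le h)
  · rintro ⟨C, hC⟩
    obtain ⟨F, hF, -, hFL⟩ := hL
    exact hFL.mapsOf_finite hF hC

end AutOrbit
end

section
/- Let T = (Q, Σ, δ) be a G-automaton. Then the automaton group G(T) is infinite if and only if there is an ω-word ξ ∈ Σ^ω such that the orbit Q*∘ξ = {𝐪∘ξ ∣ 𝐪 ∈ Q*} under the non-inverse states alone is infinite. -/
/- Common framework for automaton semigroups acting on finite and infinite words.

An S-automaton over states `Q` and alphabet `A` is given by a partial deterministic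
transition function `δ : Q → A → Option (A × Q)` (with `δ q a = some (b, p)` encoding
the transition `q –a/b→ p`). -/

namespace AutOrbit

variable {Q A : Type*}

section FiniteTables

variable {X S : Type*}

theorem exists_injOn_fin {s : Set X} (hs : s.Finite) {C : ℕ} (hC : s.ncard ≤ C) :
    ∃ idx : X → Fin (C + 1), Set.InjOn idx s := by
  classical
  have := hs.to_subtype
  obtain ⟨n, ⟨e⟩⟩ := Finite.exists_equiv_fin s
  have hn : n = s.ncard := by
    rw [← Nat.card_coe_set_eq, Nat.card_congr e, Nat.card_fin]
  refine ⟨fun x => if h : x ∈ s then ⟨e ⟨x, h⟩, by have := (e ⟨x, h⟩).2; omega⟩ else 0, ?_⟩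
  intro x hx y hy hxy
  simp only [hx, hy, dif_pos, Fin.mk.injEq] at hxy
  simpa using e.injective (Fin.ext hxy)

/-- If every point lies in an invariant set of at most `C` points, then finitely many maps
generate only finitely many maps. -/
theorem finite_setOf_foldr [Finite S] (f : S → X → X) (O : X → Set X) (C : ℕ)
    (mem : ∀ u, u ∈ O u) (closed : ∀ u, ∀ v ∈ O u, ∀ s, f s v ∈ O u)
    (fin : ∀ u, (O u).Finite) (card : ∀ u, (O u).ncard ≤ C) :
    {g : X → X | ∃ l : List S, g = fun u => l.foldr f u}.Finite := by
  classical
  choose idx inj using fun u => exists_injOn_fin (fin u) (card u)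
  rcases isEmpty_or_nonempty X with hX | hX
  · exact Set.toFinite _
  let e : X → Fin (C + 1) → X := fun u => Function.invFunOn (idx u) (O u)
  have he : ∀ u, ∀ v ∈ O u, e u (idx u v) = v := fun u v hv => (inj u).leftInvOn_invFunOn hv
  let ty : X → Fin (C + 1) × (Fin (C + 1) → S → Fin (C + 1)) :=
    fun u => (idx u u, fun i s => idx u (f s (e u i)))
  let F : (Fin (C + 1) × (Fin (C + 1) → S → Fin (C + 1)) → Fin (C + 1)) → X → X :=
    fun g u => e u (g (ty u))
  refine (Set.finite_range F).subset ?_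
  rintro _ ⟨l, rfl⟩
  refine ⟨fun t => l.foldr (fun s i => t.2 i s) t.1, ?_⟩
  funext u
  have key : l.foldr f u ∈ O u ∧
      l.foldr (fun s i => (ty u).2 i s) (ty u).1 = idx u (l.foldr f u) := by
    induction l with
    | nil => exact ⟨mem u, rfl⟩
    | cons s l ih =>
      refine ⟨closed u _ ih.1 s, ?_⟩
      simp only [List.foldr_cons, ih.2]
      simp only [ty, he u _ ih.1]
  change e u (l.foldr (fun s i => (ty u).2 i s) (ty u).1) = _
  rw [key.2, he u _ key.1]

end FiniteTables

section Total

variable (d : Q → A → A × Q)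

/-- The total action of a state of a complete automaton on finite words. -/
def act : Q → List A → List A
  | _, [] => []
  | q, a :: u => (d q a).1 :: act (d q a).2 u

/-- The state reached after reading a finite word in a complete automaton. -/
def sec : Q → List A → Q
  | q, [] => q
  | q, a :: u => sec (d q a).2 u

/-- The total action of a state of a complete automaton on ω-words. -/
def omegaAct (q : Q) (ξ : ℕ → A) (n : ℕ) : A := (d (sec d q (pre ξ n)) (ξ n)).1

/-- The orbit of a finite word under all state sequences of a complete automaton. -/
def reach (u : List A) : Set (List A) := {v | ∃ l : List Q, l.foldr (act d) u = v}

@[simp] theorem length_act (q : Q) (u : List A) : (act d q u).length = u.length := by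
  induction u generalizing q with
  | nil => rfl
  | cons a u ih => simp [act, ih]

theorem act_append (q : Q) (u v : List A) :
    act d q (u ++ v) = act d q u ++ act d (sec d q u) v := by
  induction u generalizing q with
  | nil => rfl
  | cons a u ih => simp [act, sec, ih]

theorem act_injective (hd : ∀ q, Function.Injective fun a => (d q a).1) (q : Q) :
    Function.Injective (act d q) := by
  intro u v h
  induction u generalizing q v with
  | nil => cases v <;> simp_all [act]
  | cons a u ih =>
    cases v with
    | nil => simp [act] at h
    | cons b v =>
      simp only [act, List.cons.injEq] at h
      obtain rfl : a = b := hd q h.1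
      rw [ih _ h.2]

theorem length_foldr_act (l : List Q) (u : List A) :
    (l.foldr (act d) u).length = u.length := by
  induction l with
  | nil => rfl
  | cons q l ih => simp [ih]

theorem mem_reach_self (u : List A) : u ∈ reach d u := ⟨[], rfl⟩

theorem act_mem_reach {u v : List A} (hv : v ∈ reach d u) (q : Q) : act d q v ∈ reach d u := by
  obtain ⟨l, rfl⟩ := hv
  exact ⟨q :: l, rfl⟩

theorem length_of_mem_reach {u v : List A} (hv : v ∈ reach d u) : v.length = u.length := by
  obtain ⟨l, rfl⟩ := hv
  exact length_foldr_act d l u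

theorem finite_reach [Finite A] (u : List A) : (reach d u).Finite :=
  (List.finite_length_eq A u.length).subset fun _ hv => length_of_mem_reach d hv

theorem pre_succ (ξ : ℕ → A) (n : ℕ) : pre ξ (n + 1) = pre ξ n ++ [ξ n] := by
  simp only [pre, List.ofFn_succ', List.concat_eq_append]
  rfl

theorem getD_pre_succ (ξ : ℕ → A) (n : ℕ) (a : A) : (pre ξ (n + 1)).getD n a = ξ n := by
  rw [List.getD_eq_getElem _ _ (by simp [pre])]
  simp only [pre, List.getElem_ofFn]

theorem act_pre (q : Q) (ξ : ℕ → A) (n : ℕ) :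
    act d q (pre ξ n) = pre (omegaAct d q ξ) n := by
  induction n with
  | zero => rfl
  | succ n ih => rw [pre_succ, pre_succ, act_append, ih]; rfl

theorem foldr_act_pre (l : List Q) (ξ : ℕ → A) (n : ℕ) :
    l.foldr (act d) (pre ξ n) = pre (l.foldr (omegaAct d) ξ) n := by
  induction l with
  | nil => rfl
  | cons q l ih => simp only [List.foldr_cons, ih, act_pre]

/-- Words with orbits of at most `C` elements fall into finitely many classes which determine
the orbit sizes of all extensions. -/
theorem exists_finite_classification [Finite Q] [Finite A] (C : ℕ) :
    ∃ (n : ℕ) (ty : List A → Fin n), ∀ u v, (reach d u).ncard ≤ C → (reach d v).ncard ≤ C →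
      ty u = ty v → ∀ x, (reach d (v ++ x)).ncard ≤ (reach d (u ++ x)).ncard := by
  classical
  have hidx : ∀ u, ∃ idx : List A → Fin (C + 1),
      (reach d u).ncard ≤ C → Set.InjOn idx (reach d u) := by
    intro u
    by_cases h : (reach d u).ncard ≤ C
    · obtain ⟨i, hi⟩ := exists_injOn_fin (finite_reach d u) h
      exact ⟨i, fun _ => hi⟩
    · exact ⟨fun _ => 0, fun h' => absurd h' h⟩
  choose idx inj using hidx
  let e : List A → Fin (C + 1) → List A := fun u => Function.invFunOn (idx u) (reach d u)
  have he : ∀ u, (reach d u).ncard ≤ C → ∀ v ∈ reach d u, e u (idx u v) = v :=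
    fun u hu v hv => (inj u hu).leftInvOn_invFunOn hv
  let ty : List A → Fin (C + 1) × (Fin (C + 1) → Q → Fin (C + 1) × Q) :=
    fun u => (idx u u, fun i q => (idx u (act d q (e u i)), sec d q (e u i)))
  obtain ⟨n, ⟨ε⟩⟩ :=
    Finite.exists_equiv_fin (Fin (C + 1) × (Fin (C + 1) → Q → Fin (C + 1) × Q))
  refine ⟨n, fun u => ε (ty u), fun u v hu hv huv x => ?_⟩
  replace huv : ty u = ty v := ε.injective huv
  have h₂ : ∀ i q, idx u (act d q (e u i)) = idx v (act d q (e v i)) ∧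
      sec d q (e u i) = sec d q (e v i) := fun i q => by
    simpa [ty] using congrFun (congrFun (congrArg Prod.snd huv) i) q
  have key : ∀ l : List Q, ∃ a ∈ reach d u, ∃ b ∈ reach d v, ∃ y, idx u a = idx v b ∧
      l.foldr (act d) (u ++ x) = a ++ y ∧ l.foldr (act d) (v ++ x) = b ++ y := by
    intro l
    induction l with
    | nil => exact ⟨u, mem_reach_self d u, v, mem_reach_self d v, x,
        congrArg Prod.fst huv, rfl, rfl⟩
    | cons q l ih =>
      obtain ⟨a, ha, b, hb, y, hab, hay, hby⟩ := ih
      have h := h₂ (idx u a) q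
      have hb' := he v hv b hb
      rw [← hab] at hb'
      rw [he u hu a ha, hb'] at h
      refine ⟨_, act_mem_reach d ha q, _, act_mem_reach d hb q, act d (sec d q a) y,
        h.1, ?_, ?_⟩
      · rw [List.foldr_cons, hay, act_append]
      · rw [List.foldr_cons, hby, act_append, h.2]
  let φ : List A → List A :=
    fun w => e v (idx u (w.take u.length)) ++ w.drop u.length
  refine (Set.ncard_le_ncard (t := φ '' reach d (u ++ x)) ?_
    ((finite_reach d _).image φ)).trans (Set.ncard_image_le (finite_reach d _))
  rintro _ ⟨l, rfl⟩
  obtain ⟨a, ha, b, hb, y, hab, hay, hby⟩ := key l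
  refine ⟨_, ⟨l, rfl⟩, ?_⟩
  have hl := length_of_mem_reach d ha
  simp only [φ, hay, hby, ← hl, List.take_left', List.drop_left', hab, he v hv b hb]

/-- A word whose extensions have unboundedly large orbits has such an extension whose orbit is
strictly larger. -/
theorem exists_larger_extension [Finite Q] [Finite A] {u : List A}
    (hu : ∀ C, ∃ x, C < (reach d (u ++ x)).ncard) :
    ∃ x, (∀ C, ∃ y, C < (reach d (u ++ x ++ y)).ncard) ∧
      (reach d u).ncard < (reach d (u ++ x)).ncard := by
  classical
  by_contra! hcon
  set C := (reach d u).ncard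
  obtain ⟨n, ty, hty⟩ := exists_finite_classification d (A := A) C
  have hB : ∀ p : Fin n × A, ∃ B, ∀ w, (reach d w).ncard ≤ C → ty w = p.1 →
      (∃ D, ∀ y, (reach d (w ++ [p.2] ++ y)).ncard ≤ D) →
      ∀ y, (reach d (w ++ [p.2] ++ y)).ncard ≤ B := by
    intro p
    by_cases h : ∃ w, (reach d w).ncard ≤ C ∧ ty w = p.1 ∧
      ∃ D, ∀ y, (reach d (w ++ [p.2] ++ y)).ncard ≤ D
    · obtain ⟨w, hw, hp, D, hD⟩ := h
      refine ⟨D, fun w' hw' hp' _ y => le_trans ?_ (hD y)⟩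
      rw [List.append_assoc, List.append_assoc]
      exact hty w w' hw hw' (hp.trans hp'.symm) _
    · exact ⟨0, fun w hw hp hD => absurd ⟨w, hw, hp, hD⟩ h⟩
  choose B hB using hB
  obtain ⟨M, hM⟩ := (Set.finite_range B).bddAbove
  have hdich : ∀ x, (∀ D, ∃ y, D < (reach d (u ++ x ++ y)).ncard) ∨
      ∀ y, (reach d (u ++ x ++ y)).ncard ≤ M := by
    intro x
    induction x using List.reverseRecOn with
    | nil => left; simpa using hu
    | append_singleton x a ih =>
      rcases ih with ih | ih
      · by_cases h : ∀ D, ∃ y, D < (reach d (u ++ (x ++ [a]) ++ y)).ncard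
        · exact Or.inl h
        · right
          push Not at h
          intro y
          rw [← List.append_assoc] at h ⊢
          exact (hB (ty (u ++ x), a) _ (hcon x ih) rfl h y).trans (hM ⟨_, rfl⟩)
      · right
        intro y
        simpa using ih ([a] ++ y)
  obtain ⟨x, hx⟩ := hu (max C M)
  rcases hdich x with h | h
  · exact absurd (hcon x h) (by have := le_max_left C M; omega)
  · have := h []
    rw [List.append_nil] at this
    have := le_max_right C M
    omega

/-- An infinite chain of proper extensions converges to an ω-word. -/
theorem exists_limit_of_chain (w : ℕ → List A) (hw : ∀ k, w k <+: w (k + 1))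
    (hlen : ∀ k, (w k).length < (w (k + 1)).length) :
    ∃ ξ : ℕ → A, ∀ k, pre ξ (w k).length = w k := by
  have hmono : ∀ i j, i ≤ j → w i <+: w j := by
    intro i j hij
    induction j, hij using Nat.le_induction with
    | base => exact List.prefix_refl _
    | succ j _ ih => exact ih.trans (hw j)
  have hk : ∀ k, k ≤ (w k).length := by
    intro k
    induction k with
    | zero => simp
    | succ k ih => have := hlen k; omega
  refine ⟨fun n => (w (n + 1))[n]'(hk (n + 1)), fun k => ?_⟩
  refine List.ext_getElem (by simp [pre]) fun i h₁ h₂ => ?_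
  simp only [pre, List.getElem_ofFn]
  rcases le_total k (i + 1) with h | h
  · exact ((hmono _ _ h).getElem h₂).symm
  · exact (hmono _ _ h).getElem (hk (i + 1))

theorem exists_omegaWord_of_unbounded [Finite Q] [Finite A]
    (h : ∀ C, ∃ x : List A, C < (reach d x).ncard) :
    ∃ ξ : ℕ → A, ∀ C, ∃ n, C ≤ (reach d (pre ξ n)).ncard := by
  let P := {u : List A // ∀ C, ∃ x, C < (reach d (u ++ x)).ncard}
  choose ext hext hlt using fun u : P => exists_larger_extension d u.2
  let w : ℕ → P := fun k =>
    k.rec ⟨[], by simpa using h⟩ fun _ u => ⟨u.1 ++ ext u, hext u⟩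
  have hsucc : ∀ k, (w (k + 1)).1 = (w k).1 ++ ext (w k) := fun k => rfl
  obtain ⟨ξ, hξ⟩ := exists_limit_of_chain (fun k => (w k).1)
    (fun k => ⟨_, (hsucc k).symm⟩) (fun k => by
      have hne : ext (w k) ≠ [] := fun h0 => by
        have := hlt (w k)
        rw [h0, List.append_nil] at this
        exact lt_irrefl _ this
      have := List.length_pos_iff.mpr hne
      simp only [hsucc, List.length_append]
      omega)
  refine ⟨ξ, fun C => ⟨(w C).1.length, ?_⟩⟩
  rw [hξ C]
  induction C with
  | zero => exact Nat.zero_le _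
  | succ k ih => rw [hsucc]; have := hlt (w k); omega

theorem stateAct_some (q : Q) (u : List A) :
    stateAct (fun q a => some (d q a)) q u = some (act d q u) := by
  induction u generalizing q with
  | nil => rfl
  | cons a u ih => simp [stateAct, act, ih]

theorem seqAct_some (l : List Q) (u : List A) :
    seqAct (fun q a => some (d q a)) l u = some (l.foldr (act d) u) := by
  induction l with
  | nil => rfl
  | cons q l ih =>
    change (seqAct (fun q a => some (d q a)) l u).bind _ = _
    rw [ih]
    exact stateAct_some d q _

theorem totAct_some (q : Q) : totAct (fun q a => some (d q a)) q = act d q := by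
  funext u
  simp [totAct, stateAct_some]

theorem foldr_omegaAct_mem (l : List Q) (ξ : ℕ → A) :
    l.foldr (omegaAct d) ξ ∈ omegaOrbit (fun q a => some (d q a)) Set.univ ξ :=
  ⟨l, Set.mem_univ l, fun n => by rw [seqAct_some, foldr_act_pre]⟩

theorem ncard_reach_pre_le {ξ : ℕ → A}
    (h : (omegaOrbit (fun q a => some (d q a)) Set.univ ξ).Finite) (n : ℕ) :
    (reach d (pre ξ n)).ncard ≤
      (omegaOrbit (fun q a => some (d q a)) Set.univ ξ).ncard := by
  refine (Set.ncard_le_ncard ?_ (h.image fun η => pre η n)).trans (Set.ncard_image_le h)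
  rintro _ ⟨l, rfl⟩
  exact ⟨_, foldr_omegaAct_mem d l ξ, (foldr_act_pre d l ξ n).symm⟩

theorem gAct_mem_reach [Finite A] (hd : ∀ q, Function.Injective fun a => (d q a).1)
    {u v : List A} (hv : v ∈ reach d u) (s : Q ⊕ Q) :
    gAct (fun q a => some (d q a)) s v ∈ reach d u := by
  rcases s with q | q
  · simpa [gAct, totAct_some] using act_mem_reach d hv q
  · have himage : act d q '' reach d u = reach d u :=
      Set.eq_of_subset_of_ncard_le (Set.image_subset_iff.mpr fun w hw => act_mem_reach d hw q)
        (Set.ncard_image_of_injective _ (act_injective d hd q)).ge (finite_reach d u)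
    rw [← himage] at hv
    obtain ⟨w, hw, rfl⟩ := hv
    simpa [gAct, totAct_some, Function.leftInverse_invFun (act_injective d hd q) w] using hw

theorem finite_autGroup_of_bounded [Finite Q] [Finite A]
    (hd : ∀ q, Function.Injective fun a => (d q a).1) {C : ℕ}
    (hC : ∀ u, (reach d u).ncard ≤ C) : (autGroup fun q a => some (d q a)).Finite := by
  refine (finite_setOf_foldr (gAct fun q a => some (d q a)) (reach d) C (mem_reach_self d)
    (fun u v hv s => gAct_mem_reach d hd hv s) (finite_reach d) hC).subset ?_
  rintro _ ⟨l, -, rfl⟩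
  exact ⟨l, rfl⟩

theorem gSeqAct_map_inl (l : List Q) (u : List A) :
    gSeqAct (fun q a => some (d q a)) (l.map Sum.inl) u = l.foldr (act d) u := by
  induction l with
  | nil => rfl
  | cons q l ih =>
    change gAct _ (Sum.inl q) (gSeqAct _ (l.map Sum.inl) u) = _
    rw [ih]
    simp [gAct, totAct_some]

theorem omegaOrbit_finite_of_autGroup_finite
    (h : (autGroup fun q a => some (d q a)).Finite) (ξ : ℕ → A) :
    (omegaOrbit (fun q a => some (d q a)) Set.univ ξ).Finite := by
  refine ((h.image fun f n => (f (pre ξ (n + 1))).getD n (ξ n)).insert ξ).subset ?_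
  rintro η ⟨l, -, hl⟩
  rcases eq_or_ne l [] with rfl | hne
  · left
    funext n
    have := hl (n + 1)
    rw [seqAct_some] at this
    have := congrArg (fun v => v.getD n (ξ n)) (Option.some.inj this)
    simpa only [List.foldr_nil, getD_pre_succ] using this.symm
  · right
    refine ⟨_, ⟨l.map Sum.inl, by simpa using hne, rfl⟩, ?_⟩
    funext n
    have := hl (n + 1)
    rw [seqAct_some] at this
    simp only [gSeqAct_map_inl, Option.some.inj this, getD_pre_succ]

end Total

/-- For a G-automaton `T`, the automaton group `G(T)` is infinite iff
there is an ω-word `ξ` whose orbit `Q*∘ξ` under the non-inverse states alone is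
infinite. -/
theorem group_infinite_iff_omegaOrbit_infinite {Q A : Type*} [Fintype Q] [Fintype A]
    [Nonempty A] (δ : Q → A → Option (A × Q)) (hG : GAutomaton δ) :
    (autGroup δ).Infinite ↔
      ∃ ξ : ℕ → A, (omegaOrbit δ (Set.univ : Set (List Q)) ξ).Infinite := by
  obtain ⟨hcomplete, hinv⟩ := hG
  choose d hd using fun q a => Option.isSome_iff_exists.mp (hcomplete q a)
  obtain rfl : δ = fun q a => some (d q a) := by
    funext q a
    exact hd q a
  have hinj : ∀ q, Function.Injective fun a => (d q a).1 := fun q a b hab =>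
    (hinv q (d q b).1).unique ⟨(d q a).2, by simp [← hab]⟩ ⟨(d q b).2, rfl⟩
  constructor
  · intro hinf
    have hunb : ∀ C, ∃ x : List A, C < (reach d x).ncard := by
      by_contra! h
      obtain ⟨C, hC⟩ := h
      exact hinf (finite_autGroup_of_bounded d hinj hC)
    obtain ⟨ξ, hξ⟩ := exists_omegaWord_of_unbounded d hunb
    refine ⟨ξ, fun hfin => ?_⟩
    obtain ⟨n, hn⟩ := hξ ((omegaOrbit (fun q a => some (d q a)) Set.univ ξ).ncard + 1)
    have := ncard_reach_pre_le d hfin n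
    omega
  · rintro ⟨ξ, hξ⟩ hfin
    exact hξ (omegaOrbit_finite_of_autGroup_finite d hfin ξ)

end AutOrbit
end
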